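/- For every finite set B ⊆ ℤ³ there exist finitely many finite sets S₁, …, Sₘ ⊆ ℝ³ such that P = ⋃ᵢ₌₁ᵐ convexHull(Sᵢ) satisfies: (i) P is homotopy equivalent to the continuous analog C(B); (ii) the frontier of P in ℝ³ is a topological 2-manifold; and (iii) P agrees with C(B) away from the singular points of the frontier of C(B), i.e. P \ U = C(B) \ U, where W is the set of points w of the frontier of C(B) that have no open neighborhood (in the frontier, with the subspace topology) homeomorphic to an open subset of ℝ², and U = ⋃_{w ∈ W} {x ∈ ℝ³ : max_j |x_j − w_j| ≤ 1}. (Locality of the repairing procedure: only the stars of the critical vertices are modified.) -/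

import Mathlib

/-- The continuous analog `C(B)` of a 3D binary image with foreground `B ⊆ ℤ³`. -/
def contAnalog (B : Set (Fin 3 → ℤ)) : Set (Fin 3 → ℝ) :=
  ⋃ b ∈ B, {x : Fin 3 → ℝ | ∀ j, |x j - (b j : ℝ)| ≤ 1 / 2}

/-- A subset `S` of `ℝ³` is a topological 2-manifold. -/
def Is2Manifold (S : Set (Fin 3 → ℝ)) : Prop :=
  ∀ x : S, ∃ (U : Set S) (V : Set (Fin 2 → ℝ)),
    IsOpen U ∧ IsOpen V ∧ x ∈ U ∧ Nonempty (U ≃ₜ V)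

/-- The set `W` of singular points of the frontier of `C(B)`: points with no open
neighborhood in the frontier homeomorphic to an open subset of `ℝ²`. -/
def singularSet (B : Set (Fin 3 → ℤ)) : Set (Fin 3 → ℝ) :=
  {w | ∃ hw : w ∈ frontier (contAnalog B),
    ¬ ∃ (U : Set (frontier (contAnalog B))) (V : Set (Fin 2 → ℝ)),
      IsOpen U ∧ IsOpen V ∧ (⟨w, hw⟩ : frontier (contAnalog B)) ∈ U ∧ Nonempty (U ≃ₜ V)}

/-- `U = ⋃_{w ∈ W} {x : max_j |x_j − w_j| ≤ 1}`. -/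
def singUnion (B : Set (Fin 3 → ℤ)) : Set (Fin 3 → ℝ) :=
  ⋃ w ∈ singularSet B, {x : Fin 3 → ℝ | ∀ j, |x j - w j| ≤ 1}

/-- A continuous logarithm can be transported along a homotopy of nonvanishing functions. -/
theorem exists_log_of_homotopy {A : Type*} [TopologicalSpace A] {H : unitInterval × A → ℂ}
    (hH : Continuous H) (h0 : ∀ x, H x ≠ 0)
    (hlog : ∃ g : A → ℂ, Continuous g ∧ ∀ a, Complex.exp (g a) = H (0, a)) :
    ∃ g : A → ℂ, Continuous g ∧ ∀ a, Complex.exp (g a) = H (1, a) := by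
  obtain ⟨g, hg, hgH⟩ := hlog
  let H' : C(unitInterval × A, {z : ℂ // z ≠ 0}) := ⟨fun x => ⟨H x, h0 x⟩, by fun_prop⟩
  have h0' : ∀ a, H' (0, a) = (⟨_, (g a).exp_ne_zero⟩ : {z : ℂ // z ≠ 0}) := fun a =>
    Subtype.ext (hgH a).symm
  refine ⟨fun a => Complex.isCoveringMap_exp.liftHomotopy H' ⟨g, hg⟩ h0' (1, a), by fun_prop,
    fun a => ?_⟩
  exact congrArg Subtype.val
    (congrFun (Complex.isCoveringMap_exp.liftHomotopy_lifts H' ⟨g, hg⟩ h0') (1, a))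

/-- A nonvanishing odd function on the circle has no continuous logarithm. -/
theorem Circle.not_exists_log_of_odd {g : Circle → ℂ} (hg : Continuous g)
    (hodd : ∀ z, Complex.exp (g (-z)) = -Complex.exp (g z)) : False := by
  have hexp : ∀ z, Complex.exp (g (-z) - g z) = -1 := fun z => by
    rw [Complex.exp_sub, hodd, neg_div, div_self (Complex.exp_ne_zero _)]
  have hre : ∀ z, (g (-z) - g z).re = 0 := fun z => by
    have := congrArg norm (hexp z)
    rw [Complex.norm_exp] at this
    simpa using this
  have hcont : Continuous fun t : ℝ => (g (-Circle.exp t) - g (Circle.exp t)).im := by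
    have : Continuous fun t : ℝ => -Circle.exp t := Circle.exp.continuous.neg
    have := hg.comp this
    have h2 := hg.comp Circle.exp.continuous
    exact Complex.continuous_im.comp (this.sub h2)
  have hpi : Circle.exp Real.pi = -Circle.exp 0 := by
    ext; simp
  have hzero : ∃ t : ℝ, (g (-Circle.exp t) - g (Circle.exp t)).im = 0 := by
    have hs : (g (-Circle.exp Real.pi) - g (Circle.exp Real.pi)).im =
        -(g (-Circle.exp 0) - g (Circle.exp 0)).im := by
      rw [hpi, neg_neg, ← Complex.neg_im, neg_sub]
    rcases le_total 0 (g (-Circle.exp 0) - g (Circle.exp 0)).im with h | h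
    · exact mem_range_of_exists_le_of_exists_ge hcont ⟨Real.pi, by rw [hs]; linarith⟩ ⟨0, h⟩
    · exact mem_range_of_exists_le_of_exists_ge hcont ⟨0, h⟩ ⟨Real.pi, by rw [hs]; linarith⟩
  obtain ⟨t, ht⟩ := hzero
  have h1 := hexp (Circle.exp t)
  rw [show g (-Circle.exp t) - g (Circle.exp t) = 0 from Complex.ext (hre _) ht] at h1
  norm_num at h1

/-- Planar invariance of domain: the image of the closed unit disc under an injective continuous
map is a neighborhood of the image of the center. -/
theorem Complex.image_closedBall_mem_nhds {f : ℂ → ℂ}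
    (hf : ContinuousOn f (Metric.closedBall 0 1)) (hinj : Set.InjOn f (Metric.closedBall 0 1)) :
    f '' Metric.closedBall 0 1 ∈ nhds (f 0) := by
  have hmem : ∀ z : Circle, (z : ℂ) ∈ Metric.closedBall (0 : ℂ) 1 := fun z => by
    simp [Circle.norm_coe]
  have hmem' : ∀ x : unitInterval × Circle,
      ((x.1 : ℝ) : ℂ) * x.2 ∈ Metric.closedBall (0 : ℂ) 1 := fun x => by
    simpa [abs_of_nonneg x.1.2.1, Circle.norm_coe] using x.1.2.2
  have hmem0 : (0 : ℂ) ∈ Metric.closedBall (0 : ℂ) 1 := by simp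
  have hcirc : Continuous fun z : Circle => f z := hf.comp_continuous (by fun_prop) hmem
  have hK : IsClosed (Set.range fun z : Circle => f z) := (isCompact_range hcirc).isClosed
  have h0K : f 0 ∉ Set.range fun z : Circle => f z := by
    rintro ⟨z, hz⟩
    exact z.coe_ne_zero (hinj (hmem z) hmem0 hz)
  obtain ⟨ε, hε, hball⟩ := Metric.isOpen_iff.1 hK.isOpen_compl _ h0K
  refine Filter.mem_of_superset (Metric.ball_mem_nhds _ hε) fun a ha => ?_
  by_contra hna
  have hlog0 : ∃ g : Circle → ℂ, Continuous g ∧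
      ∀ z : Circle, Complex.exp (g z) = f (((0 : unitInterval) : ℝ) * z) - a := by
    refine ⟨fun _ => Complex.log (f 0 - a), continuous_const, fun z => ?_⟩
    rw [Complex.exp_log]
    · simp
    · exact sub_ne_zero.2 fun h => hna ⟨0, hmem0, h⟩
  have hlog1 := exists_log_of_homotopy
    (H := fun x : unitInterval × Circle => f (((x.1 : ℝ) : ℂ) * x.2) - a)
    ((hf.comp_continuous (by fun_prop) hmem').sub continuous_const)
    (fun x => sub_ne_zero.2 fun h => hna ⟨_, hmem' x, h⟩) hlog0
  have hlog2 := exists_log_of_homotopy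
    (H := fun x : unitInterval × Circle => f x.2 - (a + ((x.1 : ℝ) : ℂ) * (f 0 - a)))
    (by
      have : Continuous fun x : unitInterval × Circle => f x.2 := hcirc.comp continuous_snd
      refine this.sub (continuous_const.add (Continuous.mul ?_ continuous_const))
      fun_prop)
    (fun x => sub_ne_zero.2 fun h => by
      refine hball ?_ ⟨x.2, h⟩
      refine (convex_ball (f 0) ε).add_smul_sub_mem (x := a) (y := f 0) ha
        (Metric.mem_ball_self hε) x.1.2)
    (by simpa using hlog1)
  have hlog3 := exists_log_of_homotopy
    (H := fun x : unitInterval × Circle => f x.2 - f (-(((x.1 : ℝ) : ℂ) * x.2)))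
    (by
      refine (hcirc.comp continuous_snd).sub (hf.comp_continuous (by fun_prop) fun x => ?_)
      simpa using hmem' x)
    (fun x => sub_ne_zero.2 fun h => by
      have h1 := hinj (hmem x.2) (by simpa using hmem' x) h
      have h2 : ((1 : ℂ) + (x.1 : ℝ)) * x.2 = 0 := by linear_combination h1
      rcases mul_eq_zero.1 h2 with h3 | h3
      · have := congrArg Complex.re h3
        simp at this
        linarith [x.1.2.1]
      · exact x.2.coe_ne_zero h3)
    (by simpa using hlog2)
  obtain ⟨g, hg, hexp⟩ := hlog3
  refine Circle.not_exists_log_of_odd hg fun z => ?_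
  rw [hexp, hexp]
  simp

open Topology in
/-- `S` is locally planar at `p`: some relatively open neighborhood of `p` in `S` embeds as an
open subset of the plane. -/
def LocallyPlanarAt (S : Set (Fin 3 → ℝ)) (p : Fin 3 → ℝ) : Prop :=
  ∃ O : Set (Fin 3 → ℝ), IsOpen O ∧ p ∈ O ∧
    ∃ f : ↥(S ∩ O) → (Fin 2 → ℝ), IsOpenEmbedding f

open Topology in
theorem locallyPlanarAt_iff {S : Set (Fin 3 → ℝ)} {p : Fin 3 → ℝ} (hp : p ∈ S) :
    LocallyPlanarAt S p ↔ ∃ (U : Set S) (V : Set (Fin 2 → ℝ)),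
      IsOpen U ∧ IsOpen V ∧ (⟨p, hp⟩ : S) ∈ U ∧ Nonempty (U ≃ₜ V) := by
  have key : ∀ O : Set (Fin 3 → ℝ),
      Nonempty (((↑) : S → Fin 3 → ℝ) ⁻¹' O ≃ₜ ↥(S ∩ O)) := fun O =>
    ⟨⟨⟨fun x => ⟨x.1.1, x.1.2, x.2⟩, fun x => ⟨⟨x.1, x.2.1⟩, x.2.2⟩, fun _ => rfl, fun _ => rfl⟩,
      by fun_prop, by fun_prop⟩⟩
  constructor
  · rintro ⟨O, hO, hpO, f, hf⟩
    obtain ⟨e⟩ := key O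
    exact ⟨((↑) : S → Fin 3 → ℝ) ⁻¹' O, Set.range f, hO.preimage continuous_subtype_val, hf.isOpen_range, hpO,
      ⟨e.trans hf.isEmbedding.toHomeomorph⟩⟩
  · rintro ⟨U, V, hU, hV, hpU, ⟨h⟩⟩
    obtain ⟨O, hO, rfl⟩ := isOpen_induced_iff.1 hU
    obtain ⟨e⟩ := key O
    exact ⟨O, hO, hpU, _, hV.isOpenEmbedding_subtypeVal.comp
      (e.symm.trans h).isOpenEmbedding⟩

open Topology in
theorem LocallyPlanarAt.congr {S T O : Set (Fin 3 → ℝ)} {p : Fin 3 → ℝ}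
    (h : LocallyPlanarAt S p) (hO : IsOpen O) (hp : p ∈ O) (hST : S ∩ O = T ∩ O) :
    LocallyPlanarAt T p := by
  obtain ⟨O', hO', hp', f, hf⟩ := h
  have hsub : T ∩ (O ∩ O') ⊆ S ∩ O' := fun x hx =>
    ⟨(hST.symm.subset ⟨hx.1, hx.2.1⟩).1, hx.2.2⟩
  refine ⟨O ∩ O', hO.inter hO', ⟨hp, hp'⟩, f ∘ Set.inclusion hsub, hf.comp
    ⟨IsEmbedding.inclusion hsub, ?_⟩⟩
  rw [Set.range_inclusion]
  convert hO.preimage (continuous_subtype_val (p := (· ∈ S ∩ O'))) using 1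
  ext x
  exact ⟨fun hx => hx.2.1, fun hx => ⟨(hST.subset ⟨x.2.1, hx⟩).1, hx, x.2.2⟩⟩

/-- A frontier is locally planar wherever the frontier of another set agreeing nearby is. -/
theorem LocallyPlanarAt.frontier_congr {P Q O : Set (Fin 3 → ℝ)} {p : Fin 3 → ℝ}
    (h : LocallyPlanarAt (frontier P) p) (hO : IsOpen O) (hp : p ∈ O) (hPQ : P ∩ O = Q ∩ O) :
    LocallyPlanarAt (frontier Q) p :=
  h.congr hO hp (by rw [← frontier_inter_open_inter hO, hPQ, frontier_inter_open_inter hO])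

/-- Where a closed set is locally an up-set for a coordinatewise order (with the coordinates
flipped according to the signs `s`), its frontier is locally a Lipschitz graph. -/
theorem locallyPlanarAt_frontier_of_monotone {P : Set (Fin 3 → ℝ)} {p : Fin 3 → ℝ}
    (hP : IsClosed P) (hp : p ∈ frontier P) {s : Fin 3 → ℝ} (hs : ∀ j, s j * s j = 1)
    (hmon : ∀ᶠ z : (Fin 3 → ℝ) × (Fin 3 → ℝ) in nhds (p, p),
      z.1 ∈ P → (∀ j, s j * z.1 j ≤ s j * z.2 j) → z.2 ∈ P) :
    LocallyPlanarAt (frontier P) p := by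
  obtain ⟨r, hr, hmon⟩ := Metric.eventually_nhds_iff.1 hmon
  let u : (Fin 3 → ℝ) → Fin 3 → ℝ := fun x j => s j * (x j - p j)
  let c : (Fin 3 → ℝ) → Fin 3 → ℝ := fun v j => p j + s j * v j
  have huc : ∀ v, u (c v) = v := fun v => funext fun j => by
    simp only [u, c]; linear_combination v j * hs j
  have hucont : ∀ j, Continuous fun x => u x j := fun j => by fun_prop
  have habs : ∀ j, |s j| = 1 := fun j => by
    have := hs j
    rw [← abs_mul_abs_self] at this
    nlinarith [abs_nonneg (s j)]
  have hdist : ∀ x y : Fin 3 → ℝ, ∀ j, |x j - y j| = |u x j - u y j| := fun x y j => by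
    rw [show u x j - u y j = s j * (x j - y j) by simp only [u]; ring, abs_mul, habs, one_mul]
  have hup : u p = 0 := funext fun j => by simp [u]
  have hmon' : ∀ x y, (∀ j, |u x j| < r) → (∀ j, |u y j| < r) → x ∈ P → (∀ j, u x j ≤ u y j) →
      y ∈ P := fun x y hx hy hxP hle => by
    have hball : ∀ x, (∀ j, |u x j| < r) → dist x p < r := fun x hx =>
      (dist_pi_lt_iff hr).2 fun j => by simpa [Real.dist_eq, hdist, hup] using hx j
    refine hmon (y := (x, y)) (max_lt (hball x hx) (hball y hy)) hxP fun j => ?_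
    have := hle j
    simp only [u] at this
    linarith
  have hint : ∀ x y, (∀ j, |u x j| < r) → (∀ j, |u y j| < r) → x ∈ P → (∀ j, u x j < u y j) →
      y ∈ interior P := fun x y hx hy hxP hlt => by
    rw [mem_interior_iff_mem_nhds]
    have h1 : ∀ᶠ z in nhds y, ∀ j, |u z j| < r := Filter.eventually_all.2 fun j =>
      (continuous_abs.comp (hucont j)).continuousAt.eventually_lt continuousAt_const (hy j)
    have h2 : ∀ᶠ z in nhds y, ∀ j, u x j < u z j := Filter.eventually_all.2 fun j =>
      continuousAt_const.eventually_lt (hucont j).continuousAt (hlt j)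
    filter_upwards [h1, h2] with z hz1 hz2 using hmon' x z hx hz1 hxP fun j => (hz2 j).le
  have hfP : ∀ x ∈ frontier P, x ∈ P ∧ x ∉ interior P := fun x hx => by
    rwa [hP.frontier_eq] at hx
  have hp0 : ∀ j, |u p j| < r := fun j => by simpa [hup] using hr
  let O : Set (Fin 3 → ℝ) := {x | (∀ j, |u x j| < r) ∧ |u x 0 - u x 2| < r / 4 ∧
    |u x 1 - u x 2| < r / 4}
  have hO : IsOpen O := by
    refine IsOpen.and ?_ (IsOpen.and ?_ ?_)
    · simp only [Set.ofPred_forall]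
      exact isOpen_iInter_of_finite fun j => isOpen_lt (hucont j).abs continuous_const
    · exact isOpen_lt ((hucont 0).sub (hucont 2)).abs continuous_const
    · exact isOpen_lt ((hucont 1).sub (hucont 2)).abs continuous_const
  let f : ↥(frontier P ∩ O) → Fin 2 → ℝ := fun x => ![u x 0 - u x 2, u x 1 - u x 2]
  have hf : Continuous f := by
    refine continuous_pi fun j => ?_
    fin_cases j
    · exact ((hucont 0).sub (hucont 2)).comp continuous_subtype_val
    · exact ((hucont 1).sub (hucont 2)).comp continuous_subtype_val
  have hanti : AntilipschitzWith 2 f := by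
    refine AntilipschitzWith.of_le_mul_dist fun x y => ?_
    have hxy : ¬ ∀ j, u x j < u y j := fun h =>
      (hfP _ y.2.1).2 (hint x y x.2.2.1 y.2.2.1 (hfP _ x.2.1).1 h)
    have hyx : ¬ ∀ j, u y j < u x j := fun h =>
      (hfP _ x.2.1).2 (hint y x y.2.2.1 x.2.2.1 (hfP _ y.2.1).1 h)
    have h0 := dist_le_pi_dist (f x) (f y) 0
    have h1 := dist_le_pi_dist (f x) (f y) 1
    simp only [f, Real.dist_eq, Matrix.cons_val_zero, Matrix.cons_val_one] at h0 h1
    rw [abs_le] at h0 h1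
    rw [Subtype.dist_eq, dist_pi_le_iff (by positivity)]
    have hfin : ∀ q : Fin 3 → Prop, (∀ j, q j) ↔ q 0 ∧ q 1 ∧ q 2 := fun q => by
      rw [Fin.forall_fin_succ, Fin.forall_fin_two]; rfl
    rw [hfin] at hxy hyx ⊢
    simp only [Real.dist_eq, NNReal.coe_ofNat]
    rw [hdist _ _ 0, hdist _ _ 1, hdist _ _ 2]
    set M := dist (f x) (f y)
    have hM : 0 ≤ M := dist_nonneg
    have hj : (u x 0 - u y 0 ≤ 2 * M ∧ u x 1 - u y 1 ≤ 2 * M ∧ u x 2 - u y 2 ≤ 2 * M) ∧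
        (-(2 * M) ≤ u x 0 - u y 0 ∧ -(2 * M) ≤ u x 1 - u y 1 ∧ -(2 * M) ≤ u x 2 - u y 2) := by
      constructor
      · by_contra hc
        refine hyx ?_
        by_contra hd
        grind
      · by_contra hc
        refine hxy ?_
        by_contra hd
        grind
    exact ⟨abs_le.2 ⟨hj.2.1, hj.1.1⟩, abs_le.2 ⟨hj.2.2.1, hj.1.2.1⟩,
      abs_le.2 ⟨hj.2.2.2, hj.1.2.2⟩⟩
  have hrange : Set.range f = {q | |q 0| < r / 4 ∧ |q 1| < r / 4} := by
    ext q
    constructor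
    · rintro ⟨x, rfl⟩
      exact x.2.2.2
    · rintro ⟨h0, h1⟩
      rw [abs_lt] at h0 h1
      let γ : Set.Icc (-(r / 2)) (r / 2) → Fin 3 → ℝ :=
        fun t => c ![q 0 + t, q 1 + t, (t : ℝ)]
      have hγ : Continuous γ := by
        refine continuous_pi fun j => ?_
        fin_cases j <;> simp only [γ, c] <;> simp <;> fun_prop
      have hγu : ∀ t, u (γ t) = ![q 0 + t, q 1 + t, (t : ℝ)] := fun t => huc _
      have hγr : ∀ t j, |u (γ t) j| < r := fun t j => by
        rw [hγu, abs_lt]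
        have h2 := t.2.1
        have h3 := t.2.2
        fin_cases j <;> simp <;> constructor <;> linarith
      have : PreconnectedSpace (Set.Icc (-(r / 2)) (r / 2)) :=
        Subtype.preconnectedSpace isPreconnected_Icc
      have hne : (frontier (γ ⁻¹' P)).Nonempty := by
        rw [nonempty_frontier_iff]
        refine ⟨⟨⟨r / 2, by linarith, le_rfl⟩, ?_⟩, fun h => ?_⟩
        · refine hmon' p _ hp0 (hγr _) (hfP p hp).1 fun j => ?_
          rw [hγu, hup]
          fin_cases j <;> simp <;> linarith
        · have hmem : (⟨-(r / 2), le_rfl, by linarith⟩ : Set.Icc (-(r / 2)) (r / 2)) ∈ γ ⁻¹' P := by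
            rw [h]; trivial
          refine (hfP p hp).2 (hint _ p (hγr _) hp0 hmem fun j => ?_)
          rw [hγu, hup]
          fin_cases j <;> simp <;> linarith
      obtain ⟨t, ht⟩ := hne
      refine ⟨⟨γ t, hγ.frontier_preimage_subset P ht, hγr t, ?_, ?_⟩, ?_⟩
      · rw [hγu]; simpa [abs_lt] using h0
      · rw [hγu]; simpa [abs_lt] using h1
      · ext j
        simp only [f, hγu]
        fin_cases j <;> simp
  refine ⟨O, hO, ⟨hp0, ?_⟩, f, hanti.isEmbedding hf, ?_⟩
  · simp [hup]; linarith
  · rw [hrange]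
    exact (isOpen_lt (by fun_prop) continuous_const).and (isOpen_lt (by fun_prop) continuous_const)

/-- A set containing two transverse coordinate planes near `p` is not locally planar at `p`. -/
theorem not_locallyPlanarAt_of_cross {S : Set (Fin 3 → ℝ)} {p : Fin 3 → ℝ} {i j k : Fin 3}
    (hij : i ≠ j) (hik : i ≠ k) (hjk : j ≠ k)
    (hS : ∀ᶠ x in nhds p, x j = p j ∨ x k = p k → x ∈ S) : ¬ LocallyPlanarAt S p := by
  rintro ⟨O, hO, hpO, f, hf⟩
  obtain ⟨r, hr, hball⟩ := Metric.eventually_nhds_iff.1 (hS.and (hO.mem_nhds hpO))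
  let φ : ℂ → Fin 3 → ℝ := fun z =>
    p + (Pi.single i (r / 2 * z.re) + Pi.single k (r / 2 * z.im))
  have hφi : ∀ z, φ z i = p i + r / 2 * z.re := fun z => by simp [φ, hik]
  have hφj : ∀ z, φ z j = p j := fun z => by simp [φ, hij.symm, hjk]
  have hφk : ∀ z, φ z k = p k + r / 2 * z.im := fun z => by simp [φ, hik.symm]
  have hφ : Continuous φ := by
    refine continuous_const.add (Continuous.add ?_ ?_)
    · exact (continuous_single i).comp (by fun_prop)
    · exact (continuous_single k).comp (by fun_prop)
  have hfin : ∀ l, l = i ∨ l = j ∨ l = k := by clear * - hij hik hjk; decide +revert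
  have hφmem : ∀ z ∈ Metric.closedBall (0 : ℂ) 1, φ z ∈ S ∩ O := fun z hz => by
    rw [mem_closedBall_zero_iff] at hz
    have hd : dist (φ z) p < r := (dist_pi_lt_iff hr).2 fun l => by
      have h1 := (Complex.abs_re_le_norm z).trans hz
      have h2 := (Complex.abs_im_le_norm z).trans hz
      rw [abs_le] at h1 h2
      rw [Real.dist_eq, abs_lt]
      rcases hfin l with rfl | rfl | rfl
      · rw [hφi]; constructor <;> nlinarith
      · rw [hφj]; constructor <;> linarith
      · rw [hφk]; constructor <;> nlinarith
    exact ⟨(hball hd).1 (.inl (hφj z)), (hball hd).2⟩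
  have hφinj : Function.Injective φ := fun z w h => by
    have h1 := congrFun h i
    have h2 := congrFun h k
    rw [hφi, hφi] at h1
    rw [hφk, hφk] at h2
    have hr' : r / 2 ≠ 0 := by positivity
    exact Complex.ext (mul_left_cancel₀ hr' (by linarith)) (mul_left_cancel₀ hr' (by linarith))
  have hφ0 : φ 0 = p := by simp [φ]
  let e : (Fin 2 → ℝ) ≃ₜ ℂ :=
    Homeomorph.finTwoArrow.trans Complex.equivRealProdCLM.symm.toHomeomorph
  classical
  let F : ℂ → ℂ := fun z => if h : φ z ∈ S ∩ O then e (f ⟨φ z, h⟩) else 0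
  have hF : ∀ z (h : φ z ∈ S ∩ O), F z = e (f ⟨φ z, h⟩) := fun z h => dif_pos h
  have hFc : ContinuousOn F (Metric.closedBall 0 1) := by
    rw [continuousOn_iff_continuous_domRestrict]
    have : (Metric.closedBall (0 : ℂ) 1).domRestrict F =
        fun z : Metric.closedBall (0 : ℂ) 1 => e (f ⟨φ z, hφmem z z.property⟩) := funext fun z => hF _ _
    rw [this]
    exact e.continuous.comp (hf.continuous.comp (by fun_prop))
  have hFi : Set.InjOn F (Metric.closedBall 0 1) := fun z hz w hw h => by
    rw [hF z (hφmem z hz), hF w (hφmem w hw)] at h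
    exact hφinj (congrArg Subtype.val (hf.injective (e.injective h)))
  have h0 := Complex.image_closedBall_mem_nhds hFc hFi
  have hpS : p ∈ S ∩ O := hφ0 ▸ hφmem 0 (by simp)
  have hF0 : F 0 = e (f ⟨p, hpS⟩) := by
    rw [hF 0 (hφmem 0 (by simp))]
    simp only [hφ0]
  rw [hF0] at h0
  have h1 : (fun x => e (f x)) ⁻¹' (F '' Metric.closedBall 0 1) ∈ nhds (⟨p, hpS⟩ : ↥(S ∩ O)) :=
    (e.continuous.comp hf.continuous).continuousAt h0
  obtain ⟨t, ht, hsub⟩ := mem_nhds_induced _ _ _ |>.1 h1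
  obtain ⟨δ, hδ, hδt⟩ := Metric.mem_nhds_iff.1 ht
  let x : Fin 3 → ℝ := p + Pi.single j (min r δ / 2)
  have hmin : 0 < min r δ := lt_min hr hδ
  have hxp : dist x p < min r δ := by
    have : ‖min r δ / 2‖ < min r δ := by
      rw [Real.norm_of_nonneg (by positivity)]; linarith
    simpa [x, dist_eq_norm, Pi.norm_single] using this
  have hxk : x k = p k := by simp [x, hjk.symm]
  have hxS : x ∈ S ∩ O :=
    ⟨(hball (hxp.trans_le (min_le_left _ _))).1 (.inr hxk),
      (hball (hxp.trans_le (min_le_left _ _))).2⟩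
  obtain ⟨z, hz, hzx⟩ := hsub (a := ⟨x, hxS⟩) (hδt (hxp.trans_le (min_le_right _ _)))
  rw [hF z (hφmem z hz)] at hzx
  have hxz : φ z = x := congrArg Subtype.val (hf.injective (e.injective hzx))
  have := congrFun hxz j
  rw [hφj] at this
  simp [x] at this
  linarith

/-- The closed axis-parallel box with center `c` and half side lengths `ρ`. -/
def coordBox (c ρ : Fin 3 → ℝ) : Set (Fin 3 → ℝ) := {x | ∀ j, |x j - c j| ≤ ρ j}

theorem isClosed_coordBox (c ρ : Fin 3 → ℝ) : IsClosed (coordBox c ρ) := by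
  simp only [coordBox, Set.ofPred_forall]
  exact isClosed_iInter fun j => isClosed_le (by fun_prop) continuous_const

theorem convex_coordBox (c ρ : Fin 3 → ℝ) : Convex ℝ (coordBox c ρ) := by
  have : coordBox c ρ = Set.univ.pi fun j => Metric.closedBall (c j) (ρ j) := by
    ext x; simp [coordBox, Real.dist_eq]
  rw [this]
  exact convex_pi fun j _ => convex_closedBall _ _

theorem eventually_abs_coord_sub_lt {p : Fin 3 → ℝ} {j : Fin 3} {a r : ℝ} (h : |p j - a| < r) :
    ∀ᶠ x in nhds p, |x j - a| < r :=
  (isOpen_lt (f := fun x : Fin 3 → ℝ => |x j - a|) (by fun_prop) continuous_const).mem_nhds h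

theorem mem_interior_coordBox {c ρ x : Fin 3 → ℝ} (hx : ∀ j, |x j - c j| < ρ j) :
    x ∈ interior (coordBox c ρ) := by
  rw [mem_interior_iff_mem_nhds]
  have : ∀ᶠ y in nhds x, ∀ j, |y j - c j| < ρ j := Filter.eventually_all.2 fun j =>
    eventually_abs_coord_sub_lt (hx j)
  filter_upwards [this] with y hy j using (hy j).le

theorem exists_convexHull_eq_coordBox (c : Fin 3 → ℝ) {ρ : Fin 3 → ℝ} (hρ : ∀ j, 0 ≤ ρ j) :
    ∃ S : Set (Fin 3 → ℝ), S.Finite ∧ convexHull ℝ S = coordBox c ρ := by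
  refine ⟨Set.univ.pi fun j => {c j - ρ j, c j + ρ j}, Set.Finite.pi fun j => Set.toFinite _, ?_⟩
  rw [convexHull_pi]
  ext x
  simp only [coordBox, convexHull_pair, Set.mem_pi, Set.mem_univ, true_imp_iff]
  refine forall_congr' fun j => ?_
  rw [segment_eq_Icc (by linarith [hρ j]), Set.mem_Icc, abs_le]
  constructor <;> rintro ⟨h1, h2⟩ <;> constructor <;> linarith

theorem contAnalog_eq (B : Set (Fin 3 → ℤ)) :
    contAnalog B = ⋃ b ∈ B, coordBox (fun j => (b j : ℝ)) fun _ => 1 / 2 := rfl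

theorem mem_contAnalog {B : Set (Fin 3 → ℤ)} {x : Fin 3 → ℝ} :
    x ∈ contAnalog B ↔ ∃ b ∈ B, ∀ j, |x j - (b j : ℝ)| ≤ 1 / 2 := by
  simp [contAnalog]

theorem isClosed_contAnalog {B : Set (Fin 3 → ℤ)} (hB : B.Finite) : IsClosed (contAnalog B) := by
  rw [contAnalog_eq]
  exact hB.isClosed_biUnion fun b _ => isClosed_coordBox _ _

theorem mem_singularSet {B : Set (Fin 3 → ℤ)} {w : Fin 3 → ℝ} :
    w ∈ singularSet B ↔
      w ∈ frontier (contAnalog B) ∧ ¬ LocallyPlanarAt (frontier (contAnalog B)) w := by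
  refine ⟨fun ⟨hw, h⟩ => ⟨hw, fun hl => h ((locallyPlanarAt_iff hw).1 hl)⟩, fun ⟨hw, h⟩ => ⟨hw, ?_⟩⟩
  exact fun hl => h ((locallyPlanarAt_iff hw).2 hl)

theorem is2Manifold_iff {S : Set (Fin 3 → ℝ)} :
    Is2Manifold S ↔ ∀ x ∈ S, LocallyPlanarAt S x :=
  ⟨fun h x hx => (locallyPlanarAt_iff hx).2 (h ⟨x, hx⟩),
    fun h x => (locallyPlanarAt_iff x.2).1 (h x x.2)⟩

/-- A point shared by a voxel in `B` and a voxel outside `B` is on the frontier. -/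
theorem mem_frontier_contAnalog {B : Set (Fin 3 → ℤ)} {b b' : Fin 3 → ℤ} (hb : b ∈ B)
    (hb' : b' ∉ B) {x : Fin 3 → ℝ} (hx : ∀ j, |x j - (b j : ℝ)| ≤ 1 / 2)
    (hx' : ∀ j, |x j - (b' j : ℝ)| ≤ 1 / 2) : x ∈ frontier (contAnalog B) := by
  rw [frontier_eq_closure_inter_closure]
  refine ⟨subset_closure (mem_contAnalog.2 ⟨b, hb, hx⟩), ?_⟩
  have hlim : Filter.Tendsto (fun t : ℝ => fun j => x j + t * ((b' j : ℝ) - x j))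
      (nhdsWithin 0 (Set.Ioi 0)) (nhds x) := by
    have : Continuous (fun t : ℝ => fun j => x j + t * ((b' j : ℝ) - x j)) := by fun_prop
    exact (this.tendsto' 0 x (by simp)).mono_left nhdsWithin_le_nhds
  refine mem_closure_of_tendsto hlim ?_
  filter_upwards [Ioo_mem_nhdsGT (zero_lt_one' ℝ)] with t ht hmem
  obtain ⟨d, hd, hdx⟩ := mem_contAnalog.1 hmem
  suffices d = b' from hb' (this ▸ hd)
  ext j
  have h1 := abs_le.1 (hdx j)
  have h2 := abs_le.1 (hx' j)
  have h3 : (d j : ℝ) < b' j + 1 := by nlinarith [ht.1, ht.2]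
  have h4 : (b' j : ℝ) < d j + 1 := by nlinarith [ht.1, ht.2]
  norm_cast at h3 h4
  omega

theorem Fin.three_cyclic (i : Fin 3) : i ≠ i + 1 ∧ i ≠ i + 2 ∧ i + 1 ≠ i + 2 ∧
    ∀ l, l = i ∨ l = i + 1 ∨ l = i + 2 := by
  decide +revert

/-- The voxels around the lattice edge in direction `i` through `n + (1/2, 1/2, 1/2)`. -/
def edgeCorner (n : Fin 3 → ℤ) (i : Fin 3) (α β : ℤ) : Fin 3 → ℤ :=
  n + (Pi.single (i + 1) α + Pi.single (i + 2) β)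

section edgeCorner

variable (n : Fin 3 → ℤ) (i : Fin 3) (α β : ℤ)

theorem edgeCorner_self : edgeCorner n i α β i = n i := by
  simp [edgeCorner, i.three_cyclic.1, i.three_cyclic.2.1]

theorem edgeCorner_one : edgeCorner n i α β (i + 1) = n (i + 1) + α := by
  simp [edgeCorner, i.three_cyclic.2.2.1]

theorem edgeCorner_two : edgeCorner n i α β (i + 2) = n (i + 2) + β := by
  simp [edgeCorner, i.three_cyclic.2.2.1.symm]

theorem eq_edgeCorner {b : Fin 3 → ℤ} (h0 : b i = n i) (h1 : b (i + 1) = n (i + 1) + α)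
    (h2 : b (i + 2) = n (i + 2) + β) : b = edgeCorner n i α β := by
  ext l
  rcases i.three_cyclic.2.2.2 l with rfl | rfl | rfl
  · rw [h0, edgeCorner_self]
  · rw [h1, edgeCorner_one]
  · rw [h2, edgeCorner_two]

end edgeCorner

/-- A lattice edge is critical when exactly two diagonally opposite voxels around it lie
in `B`. -/
def IsCriticalEdge (B : Set (Fin 3 → ℤ)) (n : Fin 3 → ℤ) (i : Fin 3) : Prop :=
  (edgeCorner n i 0 0 ∈ B ↔ edgeCorner n i 1 1 ∈ B) ∧
    (edgeCorner n i 0 1 ∈ B ↔ edgeCorner n i 1 0 ∈ B) ∧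
    ¬ (edgeCorner n i 0 0 ∈ B ↔ edgeCorner n i 0 1 ∈ B)

theorem IsCriticalEdge.mem_frontier_of_one {B : Set (Fin 3 → ℤ)} {n : Fin 3 → ℤ} {i : Fin 3}
    (h : IsCriticalEdge B n i) {x : Fin 3 → ℝ} (h0 : |x i - n i| ≤ 1 / 2)
    (h1 : x (i + 1) = n (i + 1) + 1 / 2) (h2 : |x (i + 2) - (n (i + 2) + 1 / 2)| ≤ 1) :
    x ∈ frontier (contAnalog B) := by
  have hbox : ∀ α β : ℤ, (α = 0 ∨ α = 1) → |x (i + 2) - (n (i + 2) + β)| ≤ 1 / 2 →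
      ∀ j, |x j - (edgeCorner n i α β j : ℝ)| ≤ 1 / 2 := fun α β hα hβ j => by
    rcases i.three_cyclic.2.2.2 j with rfl | rfl | rfl
    · rwa [edgeCorner_self]
    · rw [edgeCorner_one, h1]
      rcases hα with rfl | rfl <;> norm_num [abs_le]
    · rw [edgeCorner_two]
      exact_mod_cast hβ
  obtain ⟨β, hβ, hβx⟩ : ∃ β : ℤ, (β = 0 ∨ β = 1) ∧ |x (i + 2) - (n (i + 2) + β)| ≤ 1 / 2 := by
    rw [abs_le] at h2
    rcases le_total (x (i + 2)) (n (i + 2) + 1 / 2) with h | h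
    · exact ⟨0, .inl rfl, by rw [abs_le]; push_cast; constructor <;> linarith⟩
    · exact ⟨1, .inr rfl, by rw [abs_le]; push_cast; constructor <;> linarith⟩
  have hx0 := hbox 0 β (.inl rfl) hβx
  have hx1 := hbox 1 β (.inr rfl) hβx
  obtain ⟨e1, e2, e3⟩ := h
  by_cases hm : edgeCorner n i 0 β ∈ B
  · refine mem_frontier_contAnalog hm (b' := edgeCorner n i 1 β) (fun hm' => ?_) hx0 hx1
    rcases hβ with rfl | rfl <;> tauto
  · refine mem_frontier_contAnalog (b := edgeCorner n i 1 β) ?_ hm hx1 hx0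
    rcases hβ with rfl | rfl <;> tauto

theorem IsCriticalEdge.mem_frontier_of_two {B : Set (Fin 3 → ℤ)} {n : Fin 3 → ℤ} {i : Fin 3}
    (h : IsCriticalEdge B n i) {x : Fin 3 → ℝ} (h0 : |x i - n i| ≤ 1 / 2)
    (h1 : |x (i + 1) - (n (i + 1) + 1 / 2)| ≤ 1) (h2 : x (i + 2) = n (i + 2) + 1 / 2) :
    x ∈ frontier (contAnalog B) := by
  have hbox : ∀ α β : ℤ, (β = 0 ∨ β = 1) → |x (i + 1) - (n (i + 1) + α)| ≤ 1 / 2 →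
      ∀ j, |x j - (edgeCorner n i α β j : ℝ)| ≤ 1 / 2 := fun α β hβ hα j => by
    rcases i.three_cyclic.2.2.2 j with rfl | rfl | rfl
    · rwa [edgeCorner_self]
    · rw [edgeCorner_one]
      exact_mod_cast hα
    · rw [edgeCorner_two, h2]
      rcases hβ with rfl | rfl <;> norm_num [abs_le]
  obtain ⟨α, hα, hαx⟩ : ∃ α : ℤ, (α = 0 ∨ α = 1) ∧ |x (i + 1) - (n (i + 1) + α)| ≤ 1 / 2 := by
    rw [abs_le] at h1
    rcases le_total (x (i + 1)) (n (i + 1) + 1 / 2) with h | h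
    · exact ⟨0, .inl rfl, by rw [abs_le]; push_cast; constructor <;> linarith⟩
    · exact ⟨1, .inr rfl, by rw [abs_le]; push_cast; constructor <;> linarith⟩
  have hx0 := hbox α 0 (.inl rfl) hαx
  have hx1 := hbox α 1 (.inr rfl) hαx
  obtain ⟨e1, e2, e3⟩ := h
  by_cases hm : edgeCorner n i α 0 ∈ B
  · refine mem_frontier_contAnalog hm (b' := edgeCorner n i α 1) (fun hm' => ?_) hx0 hx1
    rcases hα with rfl | rfl <;> tauto
  · refine mem_frontier_contAnalog (b := edgeCorner n i α 1) ?_ hm hx1 hx0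
    rcases hα with rfl | rfl <;> tauto

theorem IsCriticalEdge.not_locallyPlanarAt {B : Set (Fin 3 → ℤ)} {n : Fin 3 → ℤ} {i : Fin 3}
    (h : IsCriticalEdge B n i) {p : Fin 3 → ℝ} (h0 : |p i - n i| < 1 / 2)
    (h1 : p (i + 1) = n (i + 1) + 1 / 2) (h2 : p (i + 2) = n (i + 2) + 1 / 2) :
    ¬ LocallyPlanarAt (frontier (contAnalog B)) p := by
  obtain ⟨c1, c2, c3, -⟩ := i.three_cyclic
  refine not_locallyPlanarAt_of_cross c1 c2 c3 ?_
  have e : ∀ j, p j = n j + 1 / 2 → ∀ᶠ x : Fin 3 → ℝ in nhds p, |x j - (n j + 1 / 2)| < 1 := fun j hj =>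
    eventually_abs_coord_sub_lt (by simp [hj])
  filter_upwards [eventually_abs_coord_sub_lt h0, e _ h1, e _ h2] with x hx0 hx1 hx2 hx
  rcases hx with hx | hx
  · exact h.mem_frontier_of_one hx0.le (hx.trans h1) hx2.le
  · exact h.mem_frontier_of_two hx0.le hx1.le (hx.trans h2)

/-- Every point of a closed critical edge is singular. -/
theorem IsCriticalEdge.mem_singularSet {B : Set (Fin 3 → ℤ)} {n : Fin 3 → ℤ} {i : Fin 3}
    (h : IsCriticalEdge B n i) {p : Fin 3 → ℝ} (h0 : |p i - n i| ≤ 1 / 2)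
    (h1 : p (i + 1) = n (i + 1) + 1 / 2) (h2 : p (i + 2) = n (i + 2) + 1 / 2) :
    p ∈ singularSet B := by
  obtain ⟨c1, c2, -, -⟩ := i.three_cyclic
  refine _root_.mem_singularSet.2 ⟨h.mem_frontier_of_one h0 h1 (by simp [h2]), ?_⟩
  rintro ⟨O, hO, hpO, f, hf⟩
  have hlim : Filter.Tendsto (fun t : ℝ => p + Pi.single i (t * ((n i : ℝ) - p i)))
      (nhdsWithin 0 (Set.Ioi 0)) (nhds p) := by
    have : Continuous (fun t : ℝ => p + Pi.single i (t * ((n i : ℝ) - p i))) :=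
      continuous_const.add ((continuous_single i).comp (by fun_prop))
    exact (this.tendsto' 0 p (by simp)).mono_left nhdsWithin_le_nhds
  obtain ⟨t, htO, ht⟩ :=
    ((hlim.eventually (hO.mem_nhds hpO)).and (Ioo_mem_nhdsGT (zero_lt_one' ℝ))).exists
  refine h.not_locallyPlanarAt (p := p + Pi.single i (t * ((n i : ℝ) - p i))) ?_ ?_ ?_
    ⟨O, hO, htO, f, hf⟩
  · have : (p + Pi.single i (t * ((n i : ℝ) - p i)) : Fin 3 → ℝ) i - n i = (1 - t) * (p i - n i) := by
      simp; ring
    rw [this, abs_mul, abs_of_pos (by linarith [ht.2])]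
    nlinarith [ht.1, ht.2, abs_nonneg (p i - n i)]
  · simp [c1.symm, h1]
  · simp [c2.symm, h2]

/-- Around a non-critical edge, and around any face or voxel, `B` is stable under moving voxels in
suitably chosen coordinate directions. The predicate `Z` selects the coordinates in which two
layers of voxels are present. -/
theorem exists_stable_shift {B : Set (Fin 3 → ℤ)} {n : Fin 3 → ℤ} {i : Fin 3} {Z : Fin 3 → Prop}
    (hi : ¬ Z i) (hcrit : Z (i + 1) → Z (i + 2) → ¬ IsCriticalEdge B n i) :
    ∃ t : Fin 3 → ℤ, (∀ j, t j = 0 ∨ t j = 1) ∧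
      ∀ b ∈ B, (∀ l, b l = n l ∨ Z l ∧ b l = n l + 1) → ∀ j, Z j →
        Function.update b j (n j + t j) ∈ B := by
  obtain ⟨c1, c2, c3, hcover⟩ := i.three_cyclic
  obtain ⟨α, hα, hα0, hα1⟩ : ∃ α : ℤ, (α = 0 ∨ α = 1) ∧
      (Z (i + 1) → edgeCorner n i 0 0 ∈ B ∨ edgeCorner n i 1 0 ∈ B → edgeCorner n i α 0 ∈ B) ∧
      (Z (i + 1) → Z (i + 2) → edgeCorner n i 0 1 ∈ B ∨ edgeCorner n i 1 1 ∈ B →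
        edgeCorner n i α 1 ∈ B) := by
    by_contra hc
    have h0 := fun h => hc ⟨0, .inl rfl, h⟩
    have h1 := fun h => hc ⟨1, .inr rfl, h⟩
    unfold IsCriticalEdge at hcrit
    clear hc
    grind
  obtain ⟨β, hβ, hβ0, hβ1⟩ : ∃ β : ℤ, (β = 0 ∨ β = 1) ∧
      (Z (i + 2) → edgeCorner n i 0 0 ∈ B ∨ edgeCorner n i 0 1 ∈ B → edgeCorner n i 0 β ∈ B) ∧
      (Z (i + 2) → Z (i + 1) → edgeCorner n i 1 0 ∈ B ∨ edgeCorner n i 1 1 ∈ B →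
        edgeCorner n i 1 β ∈ B) := by
    by_contra hc
    have h0 := fun h => hc ⟨0, .inl rfl, h⟩
    have h1 := fun h => hc ⟨1, .inr rfl, h⟩
    unfold IsCriticalEdge at hcrit
    clear hc
    grind
  refine ⟨fun j => if j = i + 1 then α else β, fun j => by dsimp only; split_ifs <;> assumption,
    fun b hb hbn j hj => ?_⟩
  have hb0 : b i = n i := (hbn i).resolve_right fun h => hi h.1
  obtain ⟨α', hα', hbα⟩ : ∃ α' : ℤ, (α' = 0 ∨ Z (i + 1) ∧ α' = 1) ∧
      b (i + 1) = n (i + 1) + α' := by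
    rcases hbn (i + 1) with h | ⟨h, h'⟩
    · exact ⟨0, .inl rfl, by omega⟩
    · exact ⟨1, .inr ⟨h, rfl⟩, h'⟩
  obtain ⟨β', hβ', hbβ⟩ : ∃ β' : ℤ, (β' = 0 ∨ Z (i + 2) ∧ β' = 1) ∧
      b (i + 2) = n (i + 2) + β' := by
    rcases hbn (i + 2) with h | ⟨h, h'⟩
    · exact ⟨0, .inl rfl, by omega⟩
    · exact ⟨1, .inr ⟨h, rfl⟩, h'⟩
  rw [eq_edgeCorner n i α' β' hb0 hbα hbβ] at hb
  rcases hcover j with rfl | rfl | rfl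
  · exact absurd hj hi
  · rw [eq_edgeCorner n i α β' (b := Function.update b _ _) (by simpa [c1] using hb0) (by simp)
      (by simpa [c3.symm] using hbβ)]
    rcases hβ' with rfl | ⟨hz, rfl⟩
    · rcases hα' with rfl | ⟨-, rfl⟩
      · exact hα0 hj (.inl hb)
      · exact hα0 hj (.inr hb)
    · rcases hα' with rfl | ⟨-, rfl⟩
      · exact hα1 hj hz (.inl hb)
      · exact hα1 hj hz (.inr hb)
  · rw [eq_edgeCorner n i α' β (b := Function.update b _ _) (by simpa [c2] using hb0)
      (by simpa [c3] using hbα) (by simp [c3.symm])]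
    rcases hα' with rfl | ⟨hz, rfl⟩
    · rcases hβ' with rfl | ⟨-, rfl⟩
      · exact hβ0 hj (.inl hb)
      · exact hβ0 hj (.inr hb)
    · rcases hβ' with rfl | ⟨-, rfl⟩
      · exact hβ1 hj hz (.inl hb)
      · exact hβ1 hj hz (.inr hb)

theorem eventually_contAnalog_monotone {B : Set (Fin 3 → ℤ)} {n t : Fin 3 → ℤ}
    {p s : Fin 3 → ℝ} (hlo : ∀ j, (n j : ℝ) - 1 / 2 < p j) (hhi : ∀ j, p j ≤ n j + 1 / 2)
    (ht : ∀ j, t j = 0 ∨ t j = 1)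
    (hstable : ∀ b ∈ B, (∀ l, b l = n l ∨ p l = n l + 1 / 2 ∧ b l = n l + 1) →
      ∀ j, p j = n j + 1 / 2 → Function.update b j (n j + t j) ∈ B)
    (hts : ∀ j, p j = n j + 1 / 2 → s j = 2 * t j - 1) :
    ∀ᶠ z : (Fin 3 → ℝ) × (Fin 3 → ℝ) in nhds (p, p),
      z.1 ∈ contAnalog B → (∀ j, s j * z.1 j ≤ s j * z.2 j) → z.2 ∈ contAnalog B := by
  have hev : ∀ᶠ x : Fin 3 → ℝ in nhds p, ∀ j, (n j : ℝ) - 1 / 2 < x j ∧ x j < n j + 3 / 2 ∧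
      (p j ≠ n j + 1 / 2 → x j < n j + 1 / 2) := Filter.eventually_all.2 fun j => by
    have hc : ContinuousAt (fun x : Fin 3 → ℝ => x j) p := (continuous_apply j).continuousAt
    refine (hc.eventually_const_lt (hlo j)).and ((hc.eventually_lt_const ?_).and ?_)
    · linarith [hhi j]
    · by_cases h : p j = n j + 1 / 2
      · simp [h]
      · filter_upwards [hc.eventually_lt_const (lt_of_le_of_ne (hhi j) h)] with x hx _ using hx
  have hshift : ∀ b ∈ B, (∀ l, b l = n l ∨ p l = n l + 1 / 2 ∧ b l = n l + 1) →
      ∀ J : Finset (Fin 3), (∀ j ∈ J, p j = n j + 1 / 2) →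
        (fun j => if j ∈ J then n j + t j else b j) ∈ B := fun b hb hbn J => by
    induction J using Finset.induction_on with
    | empty => exact fun _ => by simpa using hb
    | insert a J ha ih =>
      intro hJ
      have h1 := ih fun j hj => hJ j (Finset.mem_insert_of_mem hj)
      have h2 := hstable _ h1 (fun l => ?_) a (hJ a (Finset.mem_insert_self _ _))
      · convert h2 using 1
        ext j
        by_cases hja : j = a
        · subst hja; simp
        · simp [hja]
      · by_cases hl : l ∈ J
        · have := hJ l (Finset.mem_insert_of_mem hl)
          have := ht l
          simp only [hl, if_true]
          rcases this with h | h
          · exact .inl (by omega)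
          · exact .inr ⟨by assumption, by omega⟩
        · simpa only [hl, if_false] using hbn l
  filter_upwards [hev.prod_nhds hev] with ⟨x, y⟩ ⟨hx, hy⟩ hxC hle
  obtain ⟨b, hb, hbx⟩ := mem_contAnalog.1 hxC
  dsimp only at hx hy hle
  have hbn : ∀ l, b l = n l ∨ p l = n l + 1 / 2 ∧ b l = n l + 1 := fun l => by
    obtain ⟨h1, h2, h3⟩ := hx l
    have h4 := abs_le.1 (hbx l)
    have h5 : (n l : ℝ) < b l + 1 := by linarith
    have h6 : (b l : ℝ) < n l + 2 := by linarith
    norm_cast at h5 h6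
    by_cases hl : p l = n l + 1 / 2
    · rcases eq_or_ne (b l) (n l) with h | h
      · exact .inl h
      · exact .inr ⟨hl, by omega⟩
    · have h7 : (b l : ℝ) < n l + 1 := by linarith [h3 hl]
      norm_cast at h7
      exact .inl (by omega)
  classical
  let J : Finset (Fin 3) := {j | ¬ |y j - b j| ≤ 1 / 2}
  have hJ : ∀ j ∈ J, p j = n j + 1 / 2 := fun j hj => by
    by_contra hne
    have h := (hbn j).resolve_right fun h => hne h.1
    refine (Finset.mem_filter.1 hj).2 ?_
    rw [h, abs_le]
    constructor <;> linarith [hy j |>.1, hy j |>.2.2 hne]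
  refine mem_contAnalog.2 ⟨_, hshift b hb hbn J hJ, fun j => ?_⟩
  by_cases hj : j ∈ J
  · simp only [hj, if_true]
    have hp := hJ j hj
    have hne : ¬ |y j - b j| ≤ 1 / 2 := (Finset.mem_filter.1 hj).2
    have h1 := abs_le.1 (hbx j)
    have h2 := hle j
    rw [hts j hp] at h2
    obtain ⟨h3, h4, -⟩ := hy j
    rw [abs_le] at hne ⊢
    rcases hbn j with h | ⟨-, h⟩ <;> rcases ht j with h' | h' <;> rw [h'] at h2 ⊢ <;>
      rw [h] at h1 hne <;> push_cast at * <;> by_contra hcon <;> refine hne ⟨?_, ?_⟩ <;>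
      grind
  · simp only [hj, if_false]
    by_contra h
    exact hj (Finset.mem_filter.2 ⟨Finset.mem_univ _, h⟩)

theorem eventually_coordBox_monotone {c ρ p s : Fin 3 → ℝ} (hs : ∀ j, s j * s j = 1)
    (h : p ∈ coordBox c ρ → ∀ j, |p j - c j| = ρ j → 0 < s j * (c j - p j)) :
    ∀ᶠ z : (Fin 3 → ℝ) × (Fin 3 → ℝ) in nhds (p, p),
      z.1 ∈ coordBox c ρ → (∀ j, s j * z.1 j ≤ s j * z.2 j) → z.2 ∈ coordBox c ρ := by
  by_cases hp : p ∈ coordBox c ρ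
  · have hev : ∀ᶠ y in nhds p, ∀ j, |y j - c j| < ρ j ∨ 0 < s j * (c j - y j) :=
      Filter.eventually_all.2 fun j => by
        rcases (hp j).lt_or_eq with hlt | heq
        · filter_upwards [eventually_abs_coord_sub_lt hlt] with y hy using .inl hy
        · have hc : ContinuousAt (fun y : Fin 3 → ℝ => s j * (c j - y j)) p :=
            Continuous.continuousAt (by fun_prop)
          filter_upwards [hc.eventually_const_lt (h hp j heq)] with y hy using .inr hy
    filter_upwards [(continuous_snd.tendsto (p, p)).eventually hev] with ⟨x, y⟩ hy hx hle j
    rcases hy j with hlt | hpos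
    · exact hlt.le
    · have h1 := abs_le.1 (hx j)
      have h2 := hle j
      dsimp only at h1 h2 hpos ⊢
      rw [abs_le]
      rcases mul_self_eq_one_iff.1 (hs j) with hsj | hsj <;> rw [hsj] at h2 hpos <;>
        constructor <;> linarith
  · have : ∀ᶠ x in nhds p, x ∉ coordBox c ρ :=
      (isClosed_coordBox c ρ).isOpen_compl.mem_nhds hp
    filter_upwards [(continuous_fst.tendsto (p, p)).eventually this] with z hz h1
    exact absurd h1 hz

/-- The vertex `n + (1/2, 1/2, 1/2)` of the cubical grid. -/
noncomputable def vertexPt (n : Fin 3 → ℤ) : Fin 3 → ℝ := fun j => n j + 1 / 2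

/-- The midpoint of the grid edge in direction `i` ending in `vertexPt n`. -/
noncomputable def edgeMid (n : Fin 3 → ℤ) (i : Fin 3) : Fin 3 → ℝ :=
  fun j => if j = i then (n j : ℝ) else n j + 1 / 2

/-- The half side lengths of a thin box around a grid edge in direction `i`. -/
noncomputable def tubeRadius (i : Fin 3) : Fin 3 → ℝ := fun j => if j = i then 1 / 2 else 1 / 8

/-- The boxes added by the repair, as pairs of a center and half side lengths: a cube around
every singular vertex and a thin box around every critical edge. -/
def repairBoxes (B : Set (Fin 3 → ℤ)) : Set ((Fin 3 → ℝ) × (Fin 3 → ℝ)) :=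
  {k | ∃ n, vertexPt n ∈ singularSet B ∧ k = (vertexPt n, fun _ => 1 / 4)} ∪
    {k | ∃ n i, IsCriticalEdge B n i ∧ k = (edgeMid n i, tubeRadius i)}

/-- The repaired polyhedral object. -/
def repaired (B : Set (Fin 3 → ℤ)) : Set (Fin 3 → ℝ) :=
  contAnalog B ∪ ⋃ k ∈ repairBoxes B, coordBox k.1 k.2

theorem mem_coordBox_edge {n : Fin 3 → ℤ} {i : Fin 3} {x : Fin 3 → ℝ} :
    x ∈ coordBox (edgeMid n i) (tubeRadius i) ↔
      |x i - n i| ≤ 1 / 2 ∧ ∀ j, j ≠ i → |x j - (n j + 1 / 2)| ≤ 1 / 8 := by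
  refine ⟨fun h => ⟨by simpa [edgeMid, tubeRadius] using h i, fun j hj => ?_⟩, fun h j => ?_⟩
  · simpa [edgeMid, tubeRadius, hj] using h j
  · by_cases hj : j = i
    · subst hj
      simpa [edgeMid, tubeRadius] using h.1
    · simpa [edgeMid, tubeRadius, hj] using h.2 j hj

theorem IsCriticalEdge.mem_singularSet_of_forall {B : Set (Fin 3 → ℤ)} {n : Fin 3 → ℤ}
    {i : Fin 3} (h : IsCriticalEdge B n i) {p : Fin 3 → ℝ} (h0 : |p i - n i| ≤ 1 / 2)
    (h1 : ∀ j, j ≠ i → p j = n j + 1 / 2) : p ∈ singularSet B :=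
  h.mem_singularSet h0 (h1 _ i.three_cyclic.1.symm) (h1 _ i.three_cyclic.2.1.symm)

theorem singularSet_subset_contAnalog {B : Set (Fin 3 → ℤ)} (hB : B.Finite) :
    singularSet B ⊆ contAnalog B := fun _ hw =>
  (isClosed_contAnalog hB).frontier_subset hw.1

theorem Set.Finite.repairBoxes {B : Set (Fin 3 → ℤ)} (hB : B.Finite) :
    (repairBoxes B).Finite := by
  let F : Set (Fin 3 → ℤ) := ⋃ b ∈ B, Set.Icc (b - 1) b
  have hF : F.Finite := hB.biUnion fun b _ => Set.finite_Icc _ _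
  refine ((hF.image fun n => (vertexPt n, fun _ => 1 / 4)).union
    ((hF.prod Set.finite_univ).image fun k : (Fin 3 → ℤ) × Fin 3 =>
      (edgeMid k.1 k.2, tubeRadius k.2))).subset (Set.union_subset_union ?_ ?_)
  · rintro _ ⟨n, hn, rfl⟩
    obtain ⟨b, hb, hbn⟩ := mem_contAnalog.1 (singularSet_subset_contAnalog hB hn)
    have h : ∀ j, b j ≤ n j + 1 ∧ n j ≤ b j := fun j => by
      obtain ⟨h1, h2⟩ := abs_le.1 (hbn j)
      simp only [vertexPt] at h1 h2
      have h3 : (b j : ℝ) ≤ n j + 1 := by linarith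
      have h4 : (n j : ℝ) ≤ b j := by linarith
      exact_mod_cast And.intro h3 h4
    exact ⟨n, Set.mem_biUnion hb ⟨fun j => sub_le_iff_le_add.2 (h j).1, fun j => (h j).2⟩, rfl⟩
  · rintro _ ⟨n, i, h, rfl⟩
    have hcorner : ∃ α β : ℤ, (α = 0 ∨ α = 1) ∧ (β = 0 ∨ β = 1) ∧ edgeCorner n i α β ∈ B := by
      by_cases h00 : edgeCorner n i 0 0 ∈ B
      · exact ⟨0, 0, .inl rfl, .inl rfl, h00⟩
      · exact ⟨0, 1, .inl rfl, .inr rfl, by_contra fun h01 => h.2.2 (iff_of_false h00 h01)⟩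
    obtain ⟨α, β, hα, hβ, hb⟩ := hcorner
    have h : ∀ j, edgeCorner n i α β j ≤ n j + 1 ∧ n j ≤ edgeCorner n i α β j := fun j => by
      rcases i.three_cyclic.2.2.2 j with rfl | rfl | rfl
      · simp [edgeCorner_self]
      · rw [edgeCorner_one]; omega
      · rw [edgeCorner_two]; omega
    exact ⟨(n, i), ⟨Set.mem_biUnion hb ⟨fun j => sub_le_iff_le_add.2 (h j).1, fun j => (h j).2⟩,
      Set.mem_univ _⟩, rfl⟩

theorem isClosed_repaired {B : Set (Fin 3 → ℤ)} (hB : B.Finite) : IsClosed (repaired B) :=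
  (isClosed_contAnalog hB).union
    (hB.repairBoxes.isClosed_biUnion fun _ _ => isClosed_coordBox _ _)

theorem coordBox_subset_repaired {B : Set (Fin 3 → ℤ)} {k : (Fin 3 → ℝ) × (Fin 3 → ℝ)}
    (hk : k ∈ repairBoxes B) : coordBox k.1 k.2 ⊆ repaired B := fun _ hx =>
  .inr (Set.mem_biUnion hk hx)

theorem coordBox_subset_singUnion {B : Set (Fin 3 → ℤ)} {k : (Fin 3 → ℝ) × (Fin 3 → ℝ)}
    (hk : k ∈ repairBoxes B) : coordBox k.1 k.2 ⊆ singUnion B := by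
  intro x hx
  rcases hk with ⟨n, hn, rfl⟩ | ⟨n, i, h, rfl⟩
  · exact Set.mem_biUnion hn fun j => (hx j).trans (by norm_num)
  · obtain ⟨h0, h1⟩ := mem_coordBox_edge.1 hx
    refine Set.mem_biUnion (x := fun j => if j = i then x i else n j + 1 / 2)
      (h.mem_singularSet_of_forall (by simpa using h0) fun j hj => by simp [hj]) fun j => ?_
    by_cases hj : j = i
    · subst hj; simp
    · simpa [hj] using (h1 j hj).trans (by norm_num)

theorem repaired_diff_singUnion (B : Set (Fin 3 → ℤ)) :
    repaired B \ singUnion B = contAnalog B \ singUnion B := by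
  rw [repaired, Set.union_sdiff_distrib, Set.union_eq_left, Set.sdiff_eq_empty.2]
  · exact Set.empty_subset _
  · exact Set.iUnion₂_subset fun _ => coordBox_subset_singUnion

/-- The end faces of a box around a critical edge are covered by the cubes around the end points
of the edge. -/
theorem IsCriticalEdge.mem_interior_repaired {B : Set (Fin 3 → ℤ)} {n : Fin 3 → ℤ} {i : Fin 3}
    (h : IsCriticalEdge B n i) {p : Fin 3 → ℝ} (hp : p ∈ coordBox (edgeMid n i) (tubeRadius i))
    (hpi : |p i - n i| = 1 / 2) : p ∈ interior (repaired B) := by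
  obtain ⟨-, h1⟩ := mem_coordBox_edge.1 hp
  obtain ⟨m, hmi, hm⟩ : ∃ m : Fin 3 → ℤ, p i = m i + 1 / 2 ∧ ∀ j, j ≠ i → m j = n j := by
    rcases (abs_eq (by norm_num)).1 hpi with h' | h'
    · exact ⟨n, by linarith, fun _ _ => rfl⟩
    · exact ⟨Function.update n i (n i - 1), by simp; linarith, fun j hj => by simp [hj]⟩
  have hm' : vertexPt m ∈ singularSet B := h.mem_singularSet_of_forall
    (by rw [vertexPt, ← hmi]; exact hpi.le) fun j hj => by simp [vertexPt, hm j hj]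
  refine interior_mono (coordBox_subset_repaired (.inl ⟨m, hm', rfl⟩))
    (mem_interior_coordBox fun j => ?_)
  by_cases hj : j = i
  · subst hj
    simp [vertexPt, hmi]
  · simpa only [vertexPt, hm j hj] using (h1 j hj).trans_lt (by norm_num)

theorem is2Manifold_frontier_repaired {B : Set (Fin 3 → ℤ)} (hB : B.Finite) :
    Is2Manifold (frontier (repaired B)) := by
  refine is2Manifold_iff.2 fun p hp => ?_
  have hint : p ∉ interior (repaired B) := hp.2
  obtain ⟨n, hlo, hhi⟩ : ∃ n : Fin 3 → ℤ, (∀ j, (n j : ℝ) - 1 / 2 < p j) ∧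
      ∀ j, p j ≤ n j + 1 / 2 :=
    ⟨fun j => ⌈p j - 1 / 2⌉, fun j => by linarith [Int.ceil_lt_add_one (p j - 1 / 2)],
      fun j => by linarith [Int.le_ceil (p j - 1 / 2)]⟩
  by_cases hvert : ∀ j, p j = n j + 1 / 2
  · have hpv : p = vertexPt n := funext hvert
    have eq_of_lt : ∀ (m : Fin 3 → ℤ) j, |p j - (m j + 1 / 2)| < 1 → m j = n j := fun m j hj => by
      rw [hvert j, abs_lt] at hj
      have h1 : (n j : ℝ) < m j + 1 := by linarith
      have h2 : (m j : ℝ) < n j + 1 := by linarith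
      norm_cast at h1 h2
      omega
    have hps : p ∉ singularSet B := fun hps => by
      refine hint (interior_mono (coordBox_subset_repaired (.inl ⟨n, hpv ▸ hps, rfl⟩))
        (mem_interior_coordBox fun j => ?_))
      simp [hpv]
    have hpk : ∀ k ∈ repairBoxes B, p ∉ coordBox k.1 k.2 := by
      rintro _ (⟨m, hm, rfl⟩ | ⟨m, i, h, rfl⟩) hpk
      · have : m = n := funext fun j => eq_of_lt m j ((hpk j).trans_lt (by norm_num))
        exact hps (hpv ▸ this ▸ hm)
      · obtain ⟨h0, h1⟩ := mem_coordBox_edge.1 hpk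
        refine hps (h.mem_singularSet_of_forall h0 fun j hj => ?_)
        rw [hvert, eq_of_lt m j ((h1 j hj).trans_lt (by norm_num))]
    let O : Set (Fin 3 → ℝ) := (⋃ k ∈ repairBoxes B, coordBox k.1 k.2)ᶜ
    have hO : IsOpen O :=
      (hB.repairBoxes.isClosed_biUnion fun _ _ => isClosed_coordBox _ _).isOpen_compl
    have hpO : p ∈ O := by simpa [O] using hpk
    have hCO : contAnalog B ∩ O = repaired B ∩ O := by
      rw [repaired, Set.union_inter_distrib_right, Set.inter_compl_self, Set.union_empty]
    have hpC : p ∈ frontier (contAnalog B) := by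
      have : p ∈ frontier (contAnalog B) ∩ O := by
        rw [← frontier_inter_open_inter hO, hCO, frontier_inter_open_inter hO]
        exact ⟨hp, hpO⟩
      exact this.1
    refine LocallyPlanarAt.frontier_congr (by_contra fun hl => hps ?_) hO hpO hCO
    exact mem_singularSet.2 ⟨hpC, hl⟩
  push Not at hvert
  obtain ⟨i, hi⟩ := hvert
  obtain ⟨t, ht, hstable⟩ := exists_stable_shift (B := B) (n := n)
    (Z := fun j => p j = n j + 1 / 2) hi fun h1 h2 h => by
      have h0 : |p i - n i| < 1 / 2 :=
        abs_lt.2 ⟨by linarith [hlo i], by linarith [lt_of_le_of_ne (hhi i) hi]⟩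
      refine hint (interior_mono (coordBox_subset_repaired (.inr ⟨n, i, h, rfl⟩))
        (mem_interior_coordBox fun j => ?_))
      obtain ⟨c1, c2, -, hcover⟩ := i.three_cyclic
      rcases hcover j with rfl | rfl | rfl
      · simpa [edgeMid, tubeRadius] using h0
      · simp [edgeMid, tubeRadius, c1.symm, h1]
      · simp [edgeMid, tubeRadius, c2.symm, h2]
  classical
  let s : Fin 3 → ℝ := fun j =>
    if p j = n j + 1 / 2 then 2 * t j - 1 else if (n j : ℝ) < p j then 1 else -1
  have hs : ∀ j, s j * s j = 1 := fun j => by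
    rcases ht j with h | h <;> simp only [s, h] <;> split_ifs <;> norm_num
  have hside : ∀ (m : ℤ) j, p j - (m + 1 / 2) ≠ 0 → |p j - (m + 1 / 2)| < 1 / 2 →
      0 < s j * (m + 1 / 2 - p j) := fun m j h0 hlt => by
    obtain ⟨h1, h2⟩ := abs_lt.1 hlt
    have h3 := hlo j
    have h4 := hhi j
    have h5 : (m : ℝ) < n j + 1 := by linarith
    have h6 : (n j : ℝ) < m + 2 := by linarith
    norm_cast at h5 h6
    obtain rfl | hm : m = n j ∨ m = n j - 1 := by omega
    · have h7 : p j ≠ n j + 1 / 2 := fun h => h0 (by linarith)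
      have h8 := lt_of_le_of_ne h4 h7
      have h9 : (n j : ℝ) < p j := by linarith
      simp only [s, h7, h9, if_true, if_false]
      linarith
    · have h7 : (m : ℝ) = n j - 1 := by exact_mod_cast hm
      have h8 : p j < n j := by linarith
      have h9 : p j ≠ n j + 1 / 2 := by linarith
      simp only [s, h9, h8.not_gt, if_false]
      linarith
  refine locallyPlanarAt_frontier_of_monotone (isClosed_repaired hB) hp hs ?_
  have hboxes : ∀ k ∈ repairBoxes B, ∀ᶠ z : (Fin 3 → ℝ) × (Fin 3 → ℝ) in nhds (p, p),
      z.1 ∈ coordBox k.1 k.2 → (∀ j, s j * z.1 j ≤ s j * z.2 j) → z.2 ∈ coordBox k.1 k.2 := by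
    rintro _ (⟨m, hm, rfl⟩ | ⟨m, i', h, rfl⟩) <;>
      refine eventually_coordBox_monotone hs fun hpk j hj => ?_
    · refine hside (m j) j (fun h0 => ?_) ?_
      · norm_num [vertexPt, h0] at hj
      · exact hj.trans_lt (by norm_num)
    · by_cases hji : j = i'
      · subst hji
        exact absurd (h.mem_interior_repaired hpk (by simpa [edgeMid, tubeRadius] using hj)) hint
      · simp only [edgeMid, tubeRadius, hji, if_false] at hj ⊢
        refine hside (m j) j (fun h0 => ?_) (hj.trans_lt (by norm_num))
        norm_num [h0] at hj
  filter_upwards [eventually_contAnalog_monotone hlo hhi ht hstable (s := s) fun j hj => if_pos hj,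
    (Filter.eventually_all_finite hB.repairBoxes).2 hboxes] with z hC hk hz hle
  rcases hz with hz | hz
  · exact .inl (hC hz hle)
  · obtain ⟨k, hkB, hz⟩ := Set.mem_iUnion₂.1 hz
    exact .inr (Set.mem_biUnion hkB (hk k hkB hz hle))

/-- A map which moves points along segments inside `P` and inside `C ⊆ P`, and which takes `P`
into `C`, is a homotopy equivalence. -/
theorem nonempty_homotopyEquiv_of_segment_subset {E : Type*} [AddCommGroup E] [TopologicalSpace E]
    [IsTopologicalAddGroup E] [Module ℝ E] [ContinuousSMul ℝ E] {P C : Set E} (hCP : C ⊆ P)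
    {G : E → E} (hG : Continuous G) (hGC : Set.MapsTo G P C)
    (hP : ∀ x ∈ P, segment ℝ x (G x) ⊆ P) (hC : ∀ x ∈ C, segment ℝ x (G x) ⊆ C) :
    Nonempty (ContinuousMap.HomotopyEquiv ↥P ↥C) := by
  have hline : ∀ (t : unitInterval) x, AffineMap.lineMap (G x) x (t : ℝ) ∈ segment ℝ x (G x) :=
    fun t x => by
      rw [segment_symm, segment_eq_image_lineMap]
      exact Set.mem_image_of_mem _ t.2
  have hcont : Continuous fun z : unitInterval × E =>
      AffineMap.lineMap (k := ℝ) (G z.2) z.2 (z.1 : ℝ) := by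
    simp only [AffineMap.lineMap_apply_module]
    fun_prop
  refine ⟨⟨⟨fun x => ⟨G x, hGC x.2⟩, by fun_prop⟩, ⟨Set.inclusion hCP, continuous_inclusion hCP⟩,
    ⟨⟨⟨fun z => ⟨_, hP _ z.2.2 (hline z.1 z.2)⟩, ?_⟩, fun x => ?_, fun x => ?_⟩⟩,
    ⟨⟨⟨fun z => ⟨_, hC _ z.2.2 (hline z.1 z.2)⟩, ?_⟩, fun x => ?_, fun x => ?_⟩⟩⟩⟩
  · exact (hcont.comp (continuous_fst.prodMk
      (continuous_subtype_val.comp continuous_snd))).subtype_mk _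
  · exact Subtype.ext (by simp)
  · exact Subtype.ext (by simp)
  · exact (hcont.comp (continuous_fst.prodMk
      (continuous_subtype_val.comp continuous_snd))).subtype_mk _
  · exact Subtype.ext (by simp)
  · exact Subtype.ext (by simp)

/-- A map of the line which stretches the middle half of every unit interval around an integer over
the whole interval, and collapses the rest to the end points. -/
noncomputable def stretch (x : ℝ) : ℝ :=
  x + (max (-1 / 2) (min (1 / 2) (2 * (Int.fract (x + 1 / 2) - 1 / 2))) -
    (Int.fract (x + 1 / 2) - 1 / 2))

theorem continuous_stretch : Continuous stretch := by
  have h : Continuous ((fun y : ℝ => max (-1 / 2) (min (1 / 2) (2 * (y - 1 / 2))) - (y - 1 / 2)) ∘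
      Int.fract) := ContinuousOn.comp_fract'' (by fun_prop) (by norm_num)
  have h' : Continuous fun x : ℝ => x + 1 / 2 := by fun_prop
  exact continuous_id.add (h.comp h')

theorem stretch_of_abs_sub_le {x : ℝ} {n : ℤ} (h : |x - n| ≤ 1 / 2) :
    stretch x = n + max (-1 / 2) (min (1 / 2) (2 * (x - n))) := by
  obtain ⟨h1, h2⟩ := abs_le.1 h
  rcases h2.lt_or_eq with h2 | h2
  · have hfl : ⌊x + 1 / 2⌋ = n := Int.floor_eq_iff.2 ⟨by linarith, by linarith⟩
    rw [stretch, Int.fract, hfl]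
    ring_nf
  · obtain rfl : x = n + 1 / 2 := by linarith
    have hfl : Int.fract ((n : ℝ) + 1 / 2 + 1 / 2) = 0 := by
      rw [add_assoc, add_halves]
      simp
    rw [stretch, hfl]
    norm_num

theorem abs_stretch_sub_le {x : ℝ} {n : ℤ} (h : |x - n| ≤ 1 / 2) : |stretch x - n| ≤ 1 / 2 := by
  rw [stretch_of_abs_sub_le h, add_sub_cancel_left, abs_le]
  exact ⟨le_max_of_le_left (by norm_num), max_le (by norm_num) (min_le_left _ _)⟩

theorem stretch_eq_of_abs_sub_le {x : ℝ} {n : ℤ} (h : |x - (n + 1 / 2)| ≤ 1 / 4) :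
    stretch x = n + 1 / 2 := by
  obtain ⟨h1, h2⟩ := abs_le.1 h
  rcases le_total x (n + 1 / 2) with h3 | h3
  · rw [stretch_of_abs_sub_le (n := n) (abs_le.2 ⟨by linarith, by linarith⟩),
      min_eq_left (by linarith), max_eq_right (by norm_num)]
  · rw [stretch_of_abs_sub_le (n := n + 1)
      (abs_le.2 ⟨by push_cast; linarith, by push_cast; linarith⟩),
      min_eq_right (by push_cast; linarith), max_eq_left (by push_cast; linarith)]
    push_cast
    ring

theorem homotopyEquiv_repaired {B : Set (Fin 3 → ℤ)} (hB : B.Finite) :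
    Nonempty (ContinuousMap.HomotopyEquiv ↥(repaired B) ↥(contAnalog B)) := by
  let G : (Fin 3 → ℝ) → Fin 3 → ℝ := fun x j => stretch (x j)
  have hG : Continuous G := continuous_pi fun j => continuous_stretch.comp (continuous_apply j)
  have hGB : ∀ (b : Fin 3 → ℤ) (x : Fin 3 → ℝ), (∀ j, |x j - b j| ≤ 1 / 2) →
      ∀ j, |G x j - b j| ≤ 1 / 2 :=
    fun b x hx j => abs_stretch_sub_le (hx j)
  have hGk : ∀ k ∈ repairBoxes B, ∀ x ∈ coordBox k.1 k.2,
      G x ∈ coordBox k.1 k.2 ∧ G x ∈ contAnalog B := by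
    rintro _ (⟨n, hn, rfl⟩ | ⟨n, i, h, rfl⟩) x hx
    · have hGx : G x = vertexPt n := funext fun j => stretch_eq_of_abs_sub_le (hx j)
      rw [hGx]
      exact ⟨fun j => by simp, singularSet_subset_contAnalog hB hn⟩
    · obtain ⟨h0, h1⟩ := mem_coordBox_edge.1 hx
      have h0' : |G x i - n i| ≤ 1 / 2 := abs_stretch_sub_le h0
      have h1' : ∀ j, j ≠ i → G x j = n j + 1 / 2 := fun j hj =>
        stretch_eq_of_abs_sub_le ((h1 j hj).trans (by norm_num))
      exact ⟨mem_coordBox_edge.2 ⟨h0', fun j hj => by simp [h1' j hj]⟩,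
        singularSet_subset_contAnalog hB (h.mem_singularSet_of_forall h0' h1')⟩
  have hCseg : ∀ x ∈ contAnalog B, segment ℝ x (G x) ⊆ contAnalog B := fun x hx => by
    obtain ⟨b, hb, hbx⟩ := mem_contAnalog.1 hx
    rw [contAnalog_eq]
    exact ((convex_coordBox (fun j => (b j : ℝ)) fun _ => 1 / 2).segment_subset hbx
      (hGB b x hbx)).trans (Set.subset_biUnion_of_mem (u := fun b : Fin 3 → ℤ =>
        coordBox (fun j => (b j : ℝ)) fun _ => 1 / 2) hb)
  refine nonempty_homotopyEquiv_of_segment_subset Set.subset_union_left hG ?_ ?_ hCseg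
  · rintro x (hx | hx)
    · exact hCseg x hx (right_mem_segment ℝ _ _)
    · obtain ⟨k, hk, hx⟩ := Set.mem_iUnion₂.1 hx
      exact (hGk k hk x hx).2
  · rintro x (hx | hx)
    · exact (hCseg x hx).trans Set.subset_union_left
    · obtain ⟨k, hk, hx⟩ := Set.mem_iUnion₂.1 hx
      exact ((convex_coordBox _ _).segment_subset hx (hGk k hk x hx).1).trans
        (coordBox_subset_repaired hk)

theorem exists_iUnion_convexHull_eq_repaired {B : Set (Fin 3 → ℤ)} (hB : B.Finite) :
    ∃ (m : ℕ) (S : Fin m → Set (Fin 3 → ℝ)), (∀ i, (S i).Finite) ∧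
      ⋃ i, convexHull ℝ (S i) = repaired B := by
  let K : Set ((Fin 3 → ℝ) × (Fin 3 → ℝ)) :=
    (fun b : Fin 3 → ℤ => (fun j => (b j : ℝ), fun _ => 1 / 2)) '' B ∪ repairBoxes B
  have hK : K.Finite := (hB.image _).union hB.repairBoxes
  have hKP : ⋃ k ∈ K, coordBox k.1 k.2 = repaired B := by
    rw [Set.biUnion_union, Set.biUnion_image]
    rfl
  have hρ : ∀ k ∈ K, ∀ j, 0 ≤ k.2 j := by
    rintro _ (⟨b, -, rfl⟩ | ⟨n, -, rfl⟩ | ⟨n, i, -, rfl⟩) j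
    · norm_num
    · norm_num
    · simp only [tubeRadius]
      split_ifs <;> norm_num
  choose! T hT hTK using fun k (hk : k ∈ K) => exists_convexHull_eq_coordBox k.1 (hρ k hk)
  have := hK.to_subtype
  obtain ⟨m, ⟨e⟩⟩ := Finite.exists_equiv_fin K
  refine ⟨m, fun i => T (e.symm i), fun i => hT _ (e.symm i).2, ?_⟩
  rw [e.symm.surjective.iUnion_comp fun k : K => convexHull ℝ (T k), ← hKP, Set.biUnion_eq_iUnion]
  exact Set.iUnion_congr fun k => hTK k k.2

/-- Locality of the repairing procedure: the repaired polyhedral object is homotopy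
equivalent to `C(B)`, has 2-manifold frontier, and agrees with `C(B)` away from the
singular points of the frontier of `C(B)`. -/
theorem repair_exists_local (B : Set (Fin 3 → ℤ)) (hB : B.Finite) :
    ∃ (m : ℕ) (S : Fin m → Set (Fin 3 → ℝ)),
      (∀ i, (S i).Finite) ∧
      Nonempty (ContinuousMap.HomotopyEquiv ↥(⋃ i, convexHull ℝ (S i)) ↥(contAnalog B)) ∧
      Is2Manifold (frontier (⋃ i, convexHull ℝ (S i))) ∧
      (⋃ i, convexHull ℝ (S i)) \ singUnion B = contAnalog B \ singUnion B := by
  obtain ⟨m, S, hS, hP⟩ := exists_iUnion_convexHull_eq_repaired hB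
  refine ⟨m, S, hS, ?_⟩
  rw [hP]
  exact ⟨homotopyEquiv_repaired hB, is2Manifold_frontier_repaired hB, repaired_diff_singUnion B⟩
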